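/- Let χ: Φ → {0,1} satisfy χ(−γ) = χ(γ) for all γ ∈ Φ and (−1)^{χ(α+β)} = −(−1)^{χ(α)}·(−1)^{χ(β)} whenever α, β, α+β ∈ Φ. Let t ∈ ℂ \ {0} and set w = t·Σ_{α ∈ Φ⁺} (1 + (−1)^{χ(α)}) (e_{−α} ⊗ e_α − e_α ⊗ e_{−α}) ∈ g ⊗ g, and let k = h ⊕ span_ℂ{e_γ : γ ∈ Φ, χ(γ) = 1}. Then x·w = 0 (adjoint action of g on g ⊗ g) for all x ∈ k if and only if for every γ ∈ Φ⁺ with χ(γ) = 1 and every α, β ∈ Φ⁺ with γ = α + β, one has χ(α) = χ(β) = 1. -/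

import Mathlib

open TensorProduct

set_option linter.unusedVariables false

/-- The root space of `α` relative to the subalgebra `H`:
all `x ∈ L` with `⁅y, x⁆ = α y • x` for every `y ∈ H`. -/
def rootSpace' {L : Type*} [LieRing L] [LieAlgebra ℂ L]
    (H : LieSubalgebra ℂ L) (α : Module.Dual ℂ H) : Submodule ℂ L where
  carrier := {x | ∀ y : H, ⁅(y : L), x⁆ = α y • x}
  add_mem' := by
    intro a b ha hb y
    rw [lie_add, ha y, hb y, smul_add]
  zero_mem' := by
    intro y
    rw [lie_zero, smul_zero]
  smul_mem' := by
    intro c x hx y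
    rw [lie_smul, hx y, smul_comm]

section Brackets

open LieAlgebra LieAlgebra.IsKilling LieModule

variable {K L : Type*} [Field K] [CharZero K] [LieRing L] [LieAlgebra K L]
  [IsKilling K L] [FiniteDimensional K L]
  {H : LieSubalgebra K L} [H.IsCartanSubalgebra] [IsTriangularizable K H L]

/-- In a Lie algebra with non-degenerate Killing form, the bracket of nonzero root vectors for
roots `α`, `β` does not vanish when `α + β` is a weight. -/
theorem lie_ne_zero_of_rootSpace_add_ne_bot (α β : Weight K H L) (hα : α.IsNonZero)
    (hβ : β.IsNonZero) (hαβ : rootSpace H (α + β : H → K) ≠ ⊥) {x y : L}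
    (hx : x ∈ rootSpace H α) (hx0 : x ≠ 0) (hy : y ∈ rootSpace H β) (hy0 : y ≠ 0) :
    ⁅x, y⁆ ≠ 0 := by
  obtain ⟨h, e, f, isSl2, he, hf⟩ := exists_isSl2Triple_of_weight_isNonZero hα
  obtain rfl := isSl2.h_eq_coroot hα he hf
  obtain ⟨z, hz, hz0⟩ := (chainTop α β).exists_ne_zero
  have prim : isSl2.HasPrimitiveVectorWith z (chainLength α β : K) :=
    have := lie_mem_genWeightSpace_of_mem_genWeightSpace he hz
    ⟨hz0, (chainLength_smul _ _ hz).symm, by rwa [genWeightSpace_add_chainTop _ _ hα] at this⟩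
  have htop : 1 ≤ chainTopCoeff α β := by
    have := (rootSpace_zsmul_add_ne_bot_iff α β hα 1).mp (by simpa using hαβ)
    exact_mod_cast this.1
  obtain ⟨m, hm⟩ : ∃ m, chainTopCoeff α β = m + 1 := ⟨_, (Nat.sub_add_cancel htop).symm⟩
  have hlen : m + 1 ≤ chainLength α β := hm ▸ chainTopCoeff_le_chainLength α β
  have hv0 : (toEnd K L L f ^ (m + 1)) z ≠ 0 := prim.pow_toEnd_f_ne_zero_of_eq_nat rfl hlen
  have hv : (toEnd K L L f ^ (m + 1)) z ∈ rootSpace H β := by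
    have := toEnd_pow_apply_mem hf hz (m + 1)
    convert this using 2
    rw [coe_chainTop', hm]
    simp
  obtain ⟨c, hc⟩ : ∃ c : K, c • (toEnd K L L f ^ (m + 1)) z = y := by
    simpa using (finrank_eq_one_iff_of_nonzero' ⟨_, hv⟩ (by simpa using hv0)).mp
      (finrank_rootSpace_eq_one β hβ) ⟨_, hy⟩
  obtain ⟨d, hd⟩ : ∃ d : K, d • e = x := by
    simpa using (finrank_eq_one_iff_of_nonzero' ⟨_, he⟩ (by simpa using isSl2.e_ne_zero)).mp
      (finrank_rootSpace_eq_one α hα) ⟨_, hx⟩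
  have hc0 : c ≠ 0 := by rintro rfl; exact hy0 (by simpa using hc.symm)
  have hd0 : d ≠ 0 := by rintro rfl; exact hx0 (by simpa using hd.symm)
  have hcast : ((m : K) + 1) * ((chainLength α β : K) - m) ≠ 0 := by
    refine mul_ne_zero (by exact_mod_cast m.succ_ne_zero) (sub_ne_zero.mpr ?_)
    exact_mod_cast (by omega : chainLength α β ≠ m)
  rw [← hc, ← hd, smul_lie, lie_smul, prim.lie_e_pow_succ_toEnd_f m]
  exact smul_ne_zero hd0 (smul_ne_zero hc0 (smul_ne_zero hcast
    (prim.pow_toEnd_f_ne_zero_of_eq_nat rfl (by omega))))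

end Brackets

section RootSpace

open LieAlgebra LieAlgebra.IsKilling LieModule

variable {L : Type*} [LieRing L] [LieAlgebra ℂ L] {H : LieSubalgebra ℂ L}

theorem lie_mem_rootSpace' {α β : Module.Dual ℂ H} {x y : L} (hx : x ∈ rootSpace' H α)
    (hy : y ∈ rootSpace' H β) : ⁅x, y⁆ ∈ rootSpace' H (α + β) := by
  intro h
  rw [leibniz_lie, hx h, hy h, smul_lie, lie_smul, ← add_smul, LinearMap.add_apply]

theorem killingForm_eq_zero_of_mem_rootSpace' {α β : Module.Dual ℂ H} {x y : L}
    (hx : x ∈ rootSpace' H α) (hy : y ∈ rootSpace' H β) (hαβ : α + β ≠ 0) :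
    killingForm ℂ L x y = 0 := by
  obtain ⟨h, hh⟩ : ∃ h : H, (α + β) h ≠ 0 := by
    by_contra! hcon
    exact hαβ (LinearMap.ext hcon)
  have key : killingForm ℂ L ⁅(h : L), x⁆ y = - killingForm ℂ L x ⁅(h : L), y⁆ := by
    rw [← lie_skew, map_neg, LinearMap.neg_apply, LieModule.traceForm_apply_lie_apply]
  rw [hx h, hy h, map_smul, map_smul, LinearMap.smul_apply, smul_eq_mul, smul_eq_mul] at key
  have : (α + β) h * killingForm ℂ L x y = 0 := by
    rw [LinearMap.add_apply]
    linear_combination key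
  exact (mul_eq_zero.mp this).resolve_left hh

theorem isNonZero_of_coe_eq [LieRing.IsNilpotent H]
    {α : Module.Dual ℂ H} (hα : α ≠ 0) {a : Weight ℂ H L}
    (ha : (a : H → ℂ) = α) : a.IsNonZero := by
  intro h
  refine hα (LinearMap.ext fun x ↦ ?_)
  have : (a : H → ℂ) = 0 := h
  rw [← ha, this]
  rfl

variable [FiniteDimensional ℂ L] [IsKilling ℂ L] [H.IsCartanSubalgebra]

theorem mem_rootSpace'_iff {α : Module.Dual ℂ H} {x : L} :
    x ∈ rootSpace' H α ↔ x ∈ rootSpace H α := by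
  refine ⟨fun hx ↦ weightSpace_le_genWeightSpace L (α : H → ℂ) ?_, fun hx h ↦ ?_⟩
  · exact (mem_weightSpace (α : H → ℂ) x).mpr hx
  · exact lie_eq_smul_of_mem_rootSpace hx h

theorem exists_weight_of_rootSpace'_ne_bot {α : Module.Dual ℂ H} (hα : rootSpace' H α ≠ ⊥) :
    ∃ a : Weight ℂ H L, (a : H → ℂ) = α := by
  obtain ⟨x, hx, hx0⟩ := Submodule.exists_mem_ne_zero_of_ne_bot hα
  exact ⟨⟨α, fun h ↦ hx0 (by simpa [h] using mem_rootSpace'_iff.mp hx)⟩, rfl⟩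

theorem exists_smul_eq_of_mem_rootSpace' {α : Module.Dual ℂ H} (hα : α ≠ 0) {x y : L}
    (hx : x ∈ rootSpace' H α) (hx0 : x ≠ 0) (hy : y ∈ rootSpace' H α) :
    ∃ c : ℂ, y = c • x := by
  obtain ⟨a, ha⟩ := exists_weight_of_rootSpace'_ne_bot ((Submodule.ne_bot_iff _).mpr ⟨x, hx, hx0⟩)
  rw [mem_rootSpace'_iff, ← ha] at hx hy
  obtain ⟨c, hc⟩ : ∃ c : ℂ, c • x = y := by
    simpa using (finrank_eq_one_iff_of_nonzero' ⟨_, hx⟩ (by simpa using hx0)).mp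
      (finrank_rootSpace_eq_one a (isNonZero_of_coe_eq hα ha)) ⟨_, hy⟩
  exact ⟨c, hc.symm⟩

theorem lie_ne_zero_of_mem_rootSpace' {α β : Module.Dual ℂ H} (hα : α ≠ 0) (hβ : β ≠ 0)
    (hαβ : rootSpace' H (α + β) ≠ ⊥) {x y : L}
    (hx : x ∈ rootSpace' H α) (hx0 : x ≠ 0) (hy : y ∈ rootSpace' H β) (hy0 : y ≠ 0) :
    ⁅x, y⁆ ≠ 0 := by
  obtain ⟨a, ha⟩ := exists_weight_of_rootSpace'_ne_bot ((Submodule.ne_bot_iff _).mpr ⟨x, hx, hx0⟩)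
  obtain ⟨b, hb⟩ := exists_weight_of_rootSpace'_ne_bot ((Submodule.ne_bot_iff _).mpr ⟨y, hy, hy0⟩)
  obtain ⟨c, hc⟩ := exists_weight_of_rootSpace'_ne_bot hαβ
  rw [mem_rootSpace'_iff] at hx hy
  refine lie_ne_zero_of_rootSpace_add_ne_bot a b (isNonZero_of_coe_eq hα ha)
    (isNonZero_of_coe_eq hβ hb) ?_ (ha ▸ hx) hx0 (hb ▸ hy) hy0
  rw [ha, hb, show (α + β : H → ℂ) = (α + β : Module.Dual ℂ H) from rfl, ← hc]
  exact c.genWeightSpace_ne_bot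

end RootSpace

section RootVectors

variable {L : Type*} [LieRing L] [LieAlgebra ℂ L] {H : LieSubalgebra ℂ L}
  {R : Finset (Module.Dual ℂ H)} {e : Module.Dual ℂ H → L}

theorem cartan_lie_rootVector_tmul_neg (he : ∀ α ∈ R, e α ∈ rootSpace' H α)
    (hneg : ∀ α ∈ R, -α ∈ R) {α : Module.Dual ℂ H} (hα : α ∈ R) {x : L} (hx : x ∈ H) :
    ⁅x, e α ⊗ₜ[ℂ] e (-α)⁆ = 0 := by
  have h₁ : ⁅x, e α⁆ = α ⟨x, hx⟩ • e α := he α hα ⟨x, hx⟩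
  have h₂ : ⁅x, e (-α)⁆ = (-α) ⟨x, hx⟩ • e (-α) := he _ (hneg α hα) ⟨x, hx⟩
  rw [TensorProduct.LieModule.lie_tmul_right, h₁, h₂, TensorProduct.smul_tmul,
    ← TensorProduct.tmul_add, ← add_smul]
  simp

variable [FiniteDimensional ℂ L] [LieAlgebra.IsKilling ℂ L] [H.IsCartanSubalgebra]

theorem lie_rootVector_tmul_neg_eq_neg (hR : ∀ α, α ∈ R ↔ α ≠ 0 ∧ rootSpace' H α ≠ ⊥)
    (he : ∀ α ∈ R, e α ∈ rootSpace' H α) (hneg : ∀ α ∈ R, -α ∈ R)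
    (heB : ∀ α ∈ R, killingForm ℂ L (e α) (e (-α)) = 1)
    {γ α : Module.Dual ℂ H} (hγ : γ ∈ R) (hα : α ∈ R) (hαγ : α + γ ∈ R) :
    e (α + γ) ⊗ₜ[ℂ] ⁅e γ, e (-(α + γ))⁆ = - (⁅e γ, e α⁆ ⊗ₜ[ℂ] e (-α)) := by
  have he0 : ∀ β ∈ R, e β ≠ 0 := fun β hβ h ↦ by simpa [h] using heB β hβ
  obtain ⟨c, hc⟩ : ∃ c : ℂ, ⁅e γ, e α⁆ = c • e (α + γ) :=
    exists_smul_eq_of_mem_rootSpace' ((hR _).mp hαγ).1 (he _ hαγ) (he0 _ hαγ)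
      (add_comm γ α ▸ lie_mem_rootSpace' (he γ hγ) (he α hα))
  obtain ⟨d, hd⟩ : ∃ d : ℂ, ⁅e γ, e (-(α + γ))⁆ = d • e (-α) := by
    refine exists_smul_eq_of_mem_rootSpace' ((hR _).mp (hneg _ hα)).1 (he _ (hneg _ hα))
      (he0 _ (hneg _ hα)) ?_
    have := lie_mem_rootSpace' (he γ hγ) (he _ (hneg _ hαγ))
    rwa [show γ + -(α + γ) = -α by abel] at this
  have hcd : d = -c := by
    have key : killingForm ℂ L ⁅e α, e γ⁆ (e (-(α + γ))) =
        killingForm ℂ L (e α) ⁅e γ, e (-(α + γ))⁆ :=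
      LieModule.traceForm_apply_lie_apply ℂ L L _ _ _
    rw [← lie_skew, hc, hd, map_neg, LinearMap.neg_apply, map_smul, map_smul, LinearMap.smul_apply,
      heB _ hαγ, heB _ hα] at key
    simpa using key.symm
  rw [hc, hd, hcd, TensorProduct.tmul_smul, neg_smul, TensorProduct.smul_tmul']

/-- The action of a root vector `e γ` on `∑ c α • e α ⊗ e (-α)`, provided no multiple of
`[e γ, e (-γ)]` occurs. -/
theorem lie_sum_rootVector_tmul_neg (hR : ∀ α, α ∈ R ↔ α ≠ 0 ∧ rootSpace' H α ≠ ⊥)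
    (he : ∀ α ∈ R, e α ∈ rootSpace' H α) (hneg : ∀ α ∈ R, -α ∈ R)
    (heB : ∀ α ∈ R, killingForm ℂ L (e α) (e (-α)) = 1)
    [DecidableEq (Module.Dual ℂ H)] (c : Module.Dual ℂ H → ℂ)
    {γ : Module.Dual ℂ H} (hγ : γ ∈ R) (hcγ : c γ = 0) (hcγ' : c (-γ) = 0) :
    ⁅e γ, ∑ α ∈ R, c α • (e α ⊗ₜ[ℂ] e (-α))⁆ =
      ∑ α ∈ R with α + γ ∈ R, (c α - c (α + γ)) • (⁅e γ, e α⁆ ⊗ₜ[ℂ] e (-α)) := by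
  have hzero : ∀ β ∈ R, γ + β ≠ 0 → γ + β ∉ R → ⁅e γ, e β⁆ = 0 := by
    intro β hβ hne hnot
    have hbot : rootSpace' H (γ + β) = ⊥ := by
      by_contra h
      exact hnot ((hR _).mpr ⟨hne, h⟩)
    simpa [hbot] using lie_mem_rootSpace' (he γ hγ) (he β hβ)
  have hleft : ∑ α ∈ R, c α • (⁅e γ, e α⁆ ⊗ₜ[ℂ] e (-α)) =
      ∑ α ∈ R with α + γ ∈ R, c α • (⁅e γ, e α⁆ ⊗ₜ[ℂ] e (-α)) := by
    refine (Finset.sum_filter_of_ne fun α hα hne ↦ ?_).symm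
    by_contra hnot
    rw [add_comm] at hnot
    by_cases h0 : γ + α = 0
    · rw [eq_neg_of_add_eq_zero_right h0, hcγ', zero_smul] at hne
      exact hne rfl
    · rw [hzero α hα h0 hnot, TensorProduct.zero_tmul, smul_zero] at hne
      exact hne rfl
  have hright : ∑ α ∈ R, c α • (e α ⊗ₜ[ℂ] ⁅e γ, e (-α)⁆) =
      ∑ α ∈ R with α - γ ∈ R, c α • (e α ⊗ₜ[ℂ] ⁅e γ, e (-α)⁆) := by
    refine (Finset.sum_filter_of_ne fun α hα hne ↦ ?_).symm
    by_contra hnot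
    by_cases h0 : γ + -α = 0
    · rw [← sub_eq_add_neg, sub_eq_zero] at h0
      rw [← h0, hcγ, zero_smul] at hne
      exact hne rfl
    · have hnot' : γ + -α ∉ R := fun h ↦ hnot (by simpa [sub_eq_add_neg] using hneg _ h)
      rw [hzero _ (hneg α hα) h0 hnot', TensorProduct.tmul_zero, smul_zero] at hne
      exact hne rfl
  have hshift : ∑ α ∈ R with α - γ ∈ R, c α • (e α ⊗ₜ[ℂ] ⁅e γ, e (-α)⁆) =
      ∑ α ∈ R with α + γ ∈ R, c (α + γ) • (e (α + γ) ⊗ₜ[ℂ] ⁅e γ, e (-(α + γ))⁆) := by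
    refine Finset.sum_nbij' (· - γ) (· + γ) ?_ ?_ ?_ ?_ ?_ <;> simp +contextual
  simp_rw [lie_sum, lie_smul, TensorProduct.LieModule.lie_tmul_right, smul_add]
  rw [Finset.sum_add_distrib, hleft, hright, hshift, ← Finset.sum_add_distrib]
  refine Finset.sum_congr rfl fun α hα ↦ ?_
  rw [Finset.mem_filter] at hα
  rw [lie_rootVector_tmul_neg_eq_neg hR he hneg heB hγ hα.1 hα.2, smul_neg, sub_smul,
    sub_eq_add_neg]

theorem eq_of_sum_lie_rootVector_tmul_neg_eq_zero
    (hR : ∀ α, α ∈ R ↔ α ≠ 0 ∧ rootSpace' H α ≠ ⊥)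
    (he : ∀ α ∈ R, e α ∈ rootSpace' H α) (hneg : ∀ α ∈ R, -α ∈ R)
    (heB : ∀ α ∈ R, killingForm ℂ L (e α) (e (-α)) = 1)
    [DecidableEq (Module.Dual ℂ H)] (b : Module.Dual ℂ H → ℂ)
    {γ : Module.Dual ℂ H} (hγ : γ ∈ R)
    (hsum : ∑ α ∈ R with α + γ ∈ R, b α • (⁅e γ, e α⁆ ⊗ₜ[ℂ] e (-α)) = 0)
    {α : Module.Dual ℂ H} (hα : α ∈ R) (hαγ : α + γ ∈ R) : b α = 0 := by
  have he0 : ∀ β ∈ R, e β ≠ 0 := fun β hβ h ↦ by simpa [h] using heB β hβ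
  have hne : ⁅e γ, e α⁆ ≠ 0 :=
    lie_ne_zero_of_mem_rootSpace' ((hR _).mp hγ).1 ((hR _).mp hα).1
      (add_comm α γ ▸ ((hR _).mp hαγ).2) (he γ hγ) (he0 γ hγ) (he α hα) (he0 α hα)
  have happ := congrArg ((TensorProduct.rid ℂ L).toLinearMap ∘ₗ
    (killingForm ℂ L (e α)).lTensor L) hsum
  rw [map_sum, map_zero, Finset.sum_eq_single α] at happ
  · simpa [heB α hα, hne] using happ
  · intro β hβ hβα
    rw [Finset.mem_filter] at hβ
    have : killingForm ℂ L (e α) (e (-β)) = 0 :=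
      killingForm_eq_zero_of_mem_rootSpace' (he α hα) (he _ (hneg _ hβ.1))
        (by rwa [← sub_eq_add_neg, sub_ne_zero, ne_comm])
    simp [this]
  · intro h
    exact absurd (Finset.mem_filter.mpr ⟨hα, hαγ⟩) h

end RootVectors

theorem statement15
    {L : Type*} [LieRing L] [LieAlgebra ℂ L] [FiniteDimensional ℂ L]
    [LieAlgebra.IsSimple ℂ L]
    -- `H` is a Cartan subalgebra of the simple complex Lie algebra `L`
    (H : LieSubalgebra ℂ L) [LieSubalgebra.IsCartanSubalgebra H]
    -- `Φ` is the set of roots of `L` relative to `H`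
    (Φ : Set (Module.Dual ℂ H))
    (hΦ : ∀ α : Module.Dual ℂ H, α ∈ Φ ↔ α ≠ 0 ∧ rootSpace' H α ≠ ⊥)
    (hΦneg : ∀ γ ∈ Φ, -γ ∈ Φ)
    -- `hvec lam` is the element `h_lam ∈ H` representing `lam` via the Killing form
    (hvec : Module.Dual ℂ H → H)
    (hhvec : ∀ (lam : Module.Dual ℂ H) (x : H),
      killingForm ℂ L (hvec lam : L) (x : L) = lam x)
    -- root vectors `e α ∈ g_α \ {0}` normalized by `B (e α) (e (-α)) = 1`
    (e : Module.Dual ℂ H → L)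
    (he : ∀ α ∈ Φ, e α ∈ rootSpace' H α)
    (he0 : ∀ α ∈ Φ, e α ≠ 0)
    (heB : ∀ α ∈ Φ, killingForm ℂ L (e α) (e (-α)) = 1)
    (hee : ∀ α ∈ Φ, ⁅e α, e (-α)⁆ = (hvec α : L))
    -- `Δ` is a system of simple roots for `Φ`
    (Δ : Finset (Module.Dual ℂ H)) (hΔΦ : ↑Δ ⊆ Φ)
    (hind : LinearIndependent ℂ (fun b : {x // x ∈ Δ} => (b : Module.Dual ℂ H)))
    (hbase : ∀ γ ∈ Φ, ∃ k : Module.Dual ℂ H → ℤ,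
      ((∀ b ∈ Δ, 0 ≤ k b) ∨ (∀ b ∈ Δ, k b ≤ 0)) ∧ γ = ∑ b ∈ Δ, k b • b)
    -- `Φ⁺` is the set of positive roots with respect to `Δ`
    (Φplus : Finset (Module.Dual ℂ H)) (hΦplusΦ : ↑Φplus ⊆ Φ)
    (hpm : ∀ γ ∈ Φ, (γ ∈ Φplus ∧ -γ ∉ Φplus) ∨ (γ ∉ Φplus ∧ -γ ∈ Φplus))
    (hΦpos : ∀ γ ∈ Φ, (γ ∈ Φplus ↔ ∃ k : Module.Dual ℂ H → ℕ, γ = ∑ b ∈ Δ, k b • b))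
    -- `χ : Φ → {0,1}` with `χ (-γ) = χ γ` and `(-1)^(χ (α+β)) = -(-1)^(χ α) (-1)^(χ β)`
    (χ : Module.Dual ℂ H → ℕ)
    (hχ01 : ∀ γ : Module.Dual ℂ H, χ γ = 0 ∨ χ γ = 1)
    (hχneg : ∀ γ ∈ Φ, χ (-γ) = χ γ)
    (hχsum : ∀ α ∈ Φ, ∀ β ∈ Φ, α + β ∈ Φ →
      ((-1 : ℂ) ^ (χ (α + β))) = -(((-1 : ℂ) ^ (χ α)) * ((-1 : ℂ) ^ (χ β))))
    (t : ℂ) (ht : t ≠ 0)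
    (w : L ⊗[ℂ] L)
    (hw : w = t • ∑ a ∈ Φplus, (1 + (-1 : ℂ) ^ (χ a)) •
        (e (-a) ⊗ₜ[ℂ] e a - e a ⊗ₜ[ℂ] e (-a))) :
    -- `k = h ⊕ span {e γ : χ γ = 1}` annihilates `w` iff the combinatorial condition holds
    ((∀ x ∈ H.toSubmodule ⊔
        Submodule.span ℂ {y : L | ∃ γ ∈ Φ, χ γ = 1 ∧ y = e γ},
        ⁅x, w⁆ = 0) ↔
      (∀ γ ∈ Φplus, χ γ = 1 →
        ∀ α ∈ Φplus, ∀ β ∈ Φplus, γ = α + β → χ α = 1 ∧ χ β = 1)) := by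
  classical
  have hadd : ∀ α ∈ Φplus, ∀ β ∈ Φplus, α + β ∈ Φ → α + β ∈ Φplus := by
    intro α hα β hβ hαβ
    obtain ⟨k, hk⟩ := (hΦpos α (hΦplusΦ hα)).mp hα
    obtain ⟨l, hl⟩ := (hΦpos β (hΦplusΦ hβ)).mp hβ
    refine (hΦpos _ hαβ).mpr ⟨k + l, ?_⟩
    simp_rw [Pi.add_apply, add_smul, Finset.sum_add_distrib, ← hk, ← hl]
  set R : Finset (Module.Dual ℂ H) := Φplus ∪ Φplus.image Neg.neg with hRdef
  have hRΦ : ∀ α, α ∈ R ↔ α ∈ Φ := by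
    intro α
    rw [hRdef, Finset.mem_union, Finset.mem_image]
    constructor
    · rintro (h | ⟨β, hβ, rfl⟩)
      · exact hΦplusΦ h
      · exact hΦneg _ (hΦplusΦ hβ)
    · intro h
      rcases hpm α h with h | h
      · exact Or.inl h.1
      · exact Or.inr ⟨-α, h.2, neg_neg α⟩
  have hR : ∀ α, α ∈ R ↔ α ≠ 0 ∧ rootSpace' H α ≠ ⊥ := fun α ↦ (hRΦ α).trans (hΦ α)
  have heR : ∀ α ∈ R, e α ∈ rootSpace' H α := fun α hα ↦ he α ((hRΦ α).mp hα)
  have hnegR : ∀ α ∈ R, -α ∈ R := fun α hα ↦ (hRΦ _).mpr (hΦneg α ((hRΦ α).mp hα))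
  have heBR : ∀ α ∈ R, killingForm ℂ L (e α) (e (-α)) = 1 := fun α hα ↦ heB α ((hRΦ α).mp hα)
  set c : Module.Dual ℂ H → ℂ := fun α ↦
    if α ∈ Φplus then 1 + (-1 : ℂ) ^ (χ α) else -(1 + (-1 : ℂ) ^ (χ α)) with hc
  have hcχ : ∀ α, χ α = 1 → c α = 0 := fun α h ↦ by simp [hc, h]
  have hwR : w = (-t) • ∑ α ∈ R, c α • (e α ⊗ₜ[ℂ] e (-α)) := by
    have hdisj : Disjoint Φplus (Φplus.image Neg.neg) := by
      rw [Finset.disjoint_left]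
      rintro α hα hα'
      obtain ⟨β, hβ, rfl⟩ := Finset.mem_image.mp hα'
      rcases hpm β (hΦplusΦ hβ) with h | h
      · exact h.2 hα
      · exact h.1 hβ
    rw [hw, hRdef, Finset.sum_union hdisj, Finset.sum_image neg_injective.injOn,
      ← Finset.sum_add_distrib, neg_smul, ← smul_neg, ← Finset.sum_neg_distrib]
    congr 1
    refine Finset.sum_congr rfl fun α hα ↦ ?_
    have hα' : -α ∉ Φplus := by
      rcases hpm α (hΦplusΦ hα) with h | h
      · exact h.2
      · exact absurd hα h.1
    simp only [hc, hα, hα', if_true, if_false, neg_neg, hχneg α (hΦplusΦ hα)]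
    module
  have hroot : ∀ γ ∈ Φ, χ γ = 1 → ⁅e γ, w⁆ = (-t) • ∑ α ∈ R with α + γ ∈ R,
      (c α - c (α + γ)) • (⁅e γ, e α⁆ ⊗ₜ[ℂ] e (-α)) := by
    intro γ hγ hχγ
    rw [hwR, lie_smul, lie_sum_rootVector_tmul_neg hR heR hnegR heBR c ((hRΦ γ).mpr hγ)
      (hcχ γ hχγ) (hcχ _ ((hχneg γ hγ).trans hχγ))]
  have hχadd : ∀ α ∈ Φ, ∀ γ ∈ Φ, α + γ ∈ Φ → χ γ = 1 → χ (α + γ) = χ α := by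
    intro α hα γ hγ hαγ hχγ
    have := hχsum α hα γ hγ hαγ
    rcases hχ01 α with h | h <;> rcases hχ01 (α + γ) with h' | h' <;>
      first
      | exact h'.trans h.symm
      | norm_num [h, h', hχγ] at this
  constructor
  · intro hk γ hγ hχγ α hα β hβ hγαβ
    have hγΦ := hΦplusΦ hγ
    have hαΦ := hΦplusΦ hα
    have hβΦ := hΦplusΦ hβ
    have hαneg : -α ∉ Φplus := by
      rcases hpm α hαΦ with h | h
      · exact h.2
      · exact absurd hα h.1
    have hβeq : -α + γ = β := by rw [hγαβ]; abel
    have hχβ : χ β = χ α := by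
      have := hχadd (-α) (hΦneg α hαΦ) γ hγΦ (hβeq ▸ hβΦ) hχγ
      rw [hβeq, hχneg α hαΦ] at this
      exact this
    have h0 := hk (e γ) (Submodule.mem_sup_right (Submodule.subset_span ⟨γ, hγΦ, hχγ, rfl⟩))
    rw [hroot γ hγΦ hχγ, smul_eq_zero, or_iff_right (neg_ne_zero.mpr ht)] at h0
    have hb := eq_of_sum_lie_rootVector_tmul_neg_eq_zero hR heR hnegR heBR
      (fun α ↦ c α - c (α + γ)) ((hRΦ γ).mpr hγΦ) h0 ((hRΦ _).mpr (hΦneg α hαΦ))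
      ((hRΦ _).mpr (hβeq ▸ hβΦ))
    have hχα : χ α = 1 := by
      rcases hχ01 α with h | h
      · simp only [hβeq, hc, hαneg, hβ, if_true, if_false, hχneg α hαΦ, hχβ, h] at hb
        norm_num at hb
      · exact h
    exact ⟨hχα, hχβ.trans hχα⟩
  · intro hcond x hx
    have hcond' : ∀ γ ∈ Φ, χ γ = 1 → ∀ α ∈ Φplus, ∀ β ∈ Φplus, γ = α + β → χ α = 1 := by
      intro γ hγ hχγ α hα β hβ hγαβ
      exact (hcond γ (hγαβ ▸ hadd α hα β hβ (hγαβ ▸ hγ)) hχγ α hα β hβ hγαβ).1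
    have hcroot : ∀ γ ∈ Φ, χ γ = 1 → ∀ α ∈ Φ, α + γ ∈ Φ → c α = c (α + γ) := by
      intro γ hγ hχγ α hα hαγ
      have hχα := hχadd α hα γ hγ hαγ hχγ
      by_cases h₁ : α ∈ Φplus <;> by_cases h₂ : α + γ ∈ Φplus
      · simp [hc, h₁, h₂, hχα]
      · have h₃ : -(α + γ) ∈ Φplus := ((hpm _ hαγ).resolve_left fun h ↦ h₂ h.1).2
        have : χ α = 1 := hcond' (-γ) (hΦneg γ hγ) ((hχneg γ hγ).trans hχγ) α h₁ _ h₃ (by abel)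
        rw [hcχ _ this, hcχ _ (hχα.trans this)]
      · have h₃ : -α ∈ Φplus := ((hpm _ hα).resolve_left fun h ↦ h₁ h.1).2
        have : χ α = 1 := (hχneg α hα).symm.trans (hcond' γ hγ hχγ _ h₃ _ h₂ (by abel))
        rw [hcχ _ this, hcχ _ (hχα.trans this)]
      · simp [hc, h₁, h₂, hχα]
    obtain ⟨h, hh, y, hy, rfl⟩ := Submodule.mem_sup.mp hx
    have hhw : ⁅h, w⁆ = 0 := by
      rw [hwR, lie_smul, lie_sum, Finset.sum_eq_zero, smul_zero]
      intro α hα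
      rw [lie_smul, cartan_lie_rootVector_tmul_neg heR hnegR hα hh, smul_zero]
    have hyw : ⁅y, w⁆ = 0 := by
      clear hx
      induction hy using Submodule.span_induction with
      | mem y hy =>
        obtain ⟨γ, hγ, hχγ, rfl⟩ := hy
        rw [hroot γ hγ hχγ, Finset.sum_eq_zero, smul_zero]
        intro α hα
        rw [Finset.mem_filter, hRΦ, hRΦ] at hα
        rw [hcroot γ hγ hχγ α hα.1 hα.2, sub_self, zero_smul]
      | zero => exact zero_lie w
      | add y z _ _ hy hz => rw [add_lie, hy, hz, add_zero]
      | smul a y _ hy => rw [smul_lie, hy, smul_zero]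
    rw [add_lie, hhw, hyw, add_zero]
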